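/- Let T be an acyclic bipartite tournament and M ⊆ V(T). Then the canonical sequence (V_1, V_2, …) of T is a refinement of the M-sequence (X_1, Y_1, …, X_l, Y_l) of T; that is, every set V_i of the canonical sequence of T is entirely contained in one of the sets X_j or Y_j of the M-sequence. -/

import Mathlib

open Set

variable {V : Type*}

/-- The arc relation `E` restricted to the vertex set `S` has no directed cycle. -/
def AcyclicOn (E : V → V → Prop) (S : Set V) : Prop :=
  ∀ v : V, ¬ Relation.TransGen (fun x y => x ∈ S ∧ y ∈ S ∧ E x y) v v

/-- `E` is a bipartite tournament with partite sets `A` and `B`. -/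
def IsBipartiteTournament (E : V → V → Prop) (A B : Set V) : Prop :=
  A ∪ B = Set.univ ∧ A ∩ B = ∅ ∧
  (∀ a ∈ A, ∀ b ∈ B, Xor' (E a b) (E b a)) ∧
  (∀ u ∈ A, ∀ v ∈ A, ¬ E u v) ∧
  (∀ u ∈ B, ∀ v ∈ B, ¬ E u v)

/-- `H` is a feedback vertex set: deleting `H` leaves an acyclic digraph. -/
def IsFVS (E : V → V → Prop) (H : Set V) : Prop := AcyclicOn E Hᶜ

/-- A directed cycle of length 4 (a square) on the distinct vertices `a b c d`. -/
def IsDirSquare (E : V → V → Prop) (a b c d : V) : Prop :=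
  a ≠ b ∧ a ≠ c ∧ a ≠ d ∧ b ≠ c ∧ b ≠ d ∧ c ≠ d ∧
  E a b ∧ E b c ∧ E c d ∧ E d a

/-- Out-neighborhood. -/
def OutN (E : V → V → Prop) (v : V) : Set V := {u | E v u}

/-- In-neighborhood. -/
def InN (E : V → V → Prop) (v : V) : Set V := {u | E u v}

/-- The union `X 1 ∪ ⋯ ∪ X (i-1)` of the sets preceding index `i` (1-based). -/
def SeqPrev (X : ℕ → Set V) (i : ℕ) : Set V := {v | ∃ j, 1 ≤ j ∧ j < i ∧ v ∈ X j}

/-- `X 1, …, X l` is the canonical sequence of the digraph induced by `E` on `S`: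
`X i` is the set of vertices with no incoming arc in the graph induced on
`S \ (X 1 ∪ ⋯ ∪ X (i-1))`, `l` is minimal with `X 1 ∪ ⋯ ∪ X l = S`, and
`X` is `∅` outside the indices `1, …, l`. -/
def IsCanonicalSeq (E : V → V → Prop) (S : Set V) (l : ℕ) (X : ℕ → Set V) : Prop :=
  (∀ i, 1 ≤ i → i ≤ l →
    X i = {v | v ∈ S ∧ v ∉ SeqPrev X i ∧ ∀ u ∈ S, u ∉ SeqPrev X i → ¬ E u v}) ∧
  SeqPrev X (l + 1) = S ∧
  (∀ l', l' < l → SeqPrev X (l' + 1) ≠ S) ∧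
  (∀ i, i = 0 ∨ l < i → X i = ∅)

/-- The digraph induced on `S` is `M`-consistent: for every `v ∈ S` the induced
subgraph on `M ∪ {v}` is acyclic. -/
def MConsistentOn (E : V → V → Prop) (S M : Set V) : Prop :=
  ∀ v ∈ S, AcyclicOn E (M ∪ {v})

/-- `u` and `v` are `M`-equivalent. -/
def MEquiv (E : V → V → Prop) (M : Set V) (u v : V) : Prop :=
  OutN E u ∩ M = OutN E v ∩ M ∧ InN E u ∩ M = InN E v ∩ M

/-- `v` is `(M, X i)`-equivalent: `v` is `M`-equivalent to a vertex of `X i`. -/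
def MXEquiv (E : V → V → Prop) (M : Set V) (X : ℕ → Set V) (i : ℕ) (v : V) : Prop :=
  ∃ u ∈ X i, MEquiv E M v u

/-- `v` is `(M, X i)`-conflicting. -/
def MXConflict (E : V → V → Prop) (X : ℕ → Set V) (i : ℕ) (v : V) : Prop :=
  (OutN E v ∩ X i).Nonempty ∧ (InN E v ∩ X i).Nonempty ∧
  (∀ j, j < i → OutN E v ∩ X j = ∅) ∧
  (∀ j, i < j → InN E v ∩ X j = ∅)

/-- `π` is a topological sort of the digraph induced by `E` on `S`. -/
def IsTopSortOn (E : V → V → Prop) (S : Set V) (π : V → ℕ) : Prop :=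
  Set.InjOn π S ∧ ∀ u ∈ S, ∀ w ∈ S, E u w → π u < π w

/-- `v` is `M⁻`-universal (w.r.t. the canonical sequence `X` of `T[M]`). -/
def MUnivMinus (E : V → V → Prop) (M : Set V) (X : ℕ → Set V) (v : V) : Prop :=
  (∀ i, ¬ MXEquiv E M X i v) ∧ AcyclicOn E (M ∪ {v}) ∧
  ∃ π : V → ℕ, IsTopSortOn E (M ∪ {v}) π ∧ ∀ u ∈ M ∪ {v}, u ≠ v → π v < π u

/-- `v` is `M⁺`-universal (w.r.t. the canonical sequence `X` of `T[M]`). -/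
def MUnivPlus (E : V → V → Prop) (M : Set V) (X : ℕ → Set V) (v : V) : Prop :=
  (∀ i, ¬ MXEquiv E M X i v) ∧ AcyclicOn E (M ∪ {v}) ∧
  ∃ π : V → ℕ, IsTopSortOn E (M ∪ {v}) π ∧ ∀ u ∈ M ∪ {v}, u ≠ v → π u < π v

/-- `v` is `M`-universal. -/
def MUniversal (E : V → V → Prop) (M : Set V) (X : ℕ → Set V) (v : V) : Prop :=
  MUnivMinus E M X v ∨ MUnivPlus E M X v

/-- `(X 1, Y 1, …, X l, Y l)` is the `M`-sequence of the digraph induced by `E` on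
the vertex set `S`, where `X'` is the canonical sequence of `T[M]`:  `X i` is the set
of all `(M, X' i)`-equivalent vertices of `S` and `Y i` the set of all
`(M, X' i)`-conflicting vertices of `S`, with `Y 1` additionally containing every
`M⁻`-universal vertex and `Y l` every `M⁺`-universal vertex of `S`. -/
def IsMSeqOn (E : V → V → Prop) (S M : Set V) (l : ℕ) (X' X Y : ℕ → Set V) : Prop :=
  IsCanonicalSeq E M l X' ∧
  (∀ i, 1 ≤ i → i ≤ l → X i = {w | w ∈ S ∧ MXEquiv E M X' i w}) ∧
  (∀ i, 1 ≤ i → i ≤ l → Y i =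
    {w | w ∈ S ∧ MXConflict E X' i w} ∪
    (if i = 1 then {w | w ∈ S ∧ MUnivMinus E M X' w} else ∅) ∪
    (if i = l then {w | w ∈ S ∧ MUnivPlus E M X' w} else ∅)) ∧
  (∀ i, i = 0 ∨ l < i → X i = ∅ ∧ Y i = ∅)

/-- Every collection of at least `t` consecutive vertices of `π` restricted to `S`
contains a vertex of `M`. -/
def ConsecHitsOn (π : V → ℕ) (S M : Set V) (t : ℝ) : Prop :=
  ∀ u ∈ S, ∀ w ∈ S, π u ≤ π w →
    t ≤ ({x | x ∈ S ∧ π u ≤ π x ∧ π x ≤ π w}.ncard : ℝ) →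
    ∃ m ∈ M ∩ S, π u ≤ π m ∧ π m ≤ π w

/-- A feedback vertex set `H` is `M`-homogeneous: some topological sort `π` of
`T − H` is such that every `10 (log₂ k)³` consecutive vertices of `π` restricted to
`A \ H`, respectively to `B \ H`, contain a vertex of `M`. -/
def MHomogeneous (E : V → V → Prop) (A B M H : Set V) (k : ℕ) : Prop :=
  ∃ π : V → ℕ, IsTopSortOn E Hᶜ π ∧
    ConsecHitsOn π (A \ H) M (10 * (Real.logb 2 k) ^ 3) ∧
    ConsecHitsOn π (B \ H) M (10 * (Real.logb 2 k) ^ 3)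

/-- The left boundary of block `i`: vertices of `X i` occurring before the first
`M`-vertex of `X i` in the topological sort `π`. -/
def LeftBd (π : V → ℕ) (X : ℕ → Set V) (M : Set V) (i : ℕ) : Set V :=
  {x | x ∈ X i ∧ ∀ m ∈ X i ∩ M, π x < π m}

/-- The right boundary of block `i`: vertices of `X i` occurring after the last
`M`-vertex of `X i` in the topological sort `π`. -/
def RightBd (π : V → ℕ) (X : ℕ → Set V) (M : Set V) (i : ℕ) : Set V :=
  {x | x ∈ X i ∧ ∀ m ∈ X i ∩ M, π m < π x}

/-- The vicinity of block `i`. -/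
def Vicinity (π : V → ℕ) (X Y : ℕ → Set V) (M : Set V) (i : ℕ) : Set V :=
  LeftBd π X M i ∪ RightBd π X M i ∪ Y i ∪ RightBd π X M (i - 1) ∪ LeftBd π X M (i + 1)

/-- `F` is a `t`-wise independent family of functions from `V` to `{1, …, q}`. -/
def TwiseIndep (F : Finset (V → ℕ)) (t q : ℕ) : Prop :=
  F.Nonempty ∧
  (∀ f ∈ F, ∀ v : V, f v ∈ Finset.Icc 1 q) ∧
  ∀ g : Fin t → V, Function.Injective g →
    ∀ α : Fin t → ℕ, (∀ i, α i ∈ Finset.Icc 1 q) →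
      (F.filter fun f => ∀ i, f (g i) = α i).card * q ^ t = F.card

/-- `u` and `v` are false twins. -/
def FalseTwins (E : V → V → Prop) (u v : V) : Prop :=
  ¬ E u v ∧ ¬ E v u ∧ OutN E u = OutN E v ∧ InN E u = InN E v

/-- The vertex set of a quadruple (used for vertex sets of squares). -/
def quadVerts (q : V × V × V × V) : Set V := {q.1, q.2.1, q.2.2.1, q.2.2.2}

/-- In a bipartite tournament every arc joins the two sides. -/
theorem IsBipartiteTournament.mem_iff_notMem {E : V → V → Prop} {A B : Set V}
    (hT : IsBipartiteTournament E A B) {u v : V} (h : E u v) : u ∈ A ↔ v ∉ A := by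
  obtain ⟨hU, -, -, hA, hB⟩ := hT
  have hu : u ∈ A ∨ u ∈ B := by simpa using hU.ge (mem_univ u)
  have hv : v ∈ A ∨ v ∈ B := by simpa using hU.ge (mem_univ v)
  have := hA u
  have := hB u
  grind

/-- In a bipartite tournament vertices on different sides are joined by an arc. -/
theorem IsBipartiteTournament.arc_or_arc {E : V → V → Prop} {A B : Set V}
    (hT : IsBipartiteTournament E A B) {u v : V} (h : u ∈ A ↔ v ∉ A) : E u v ∨ E v u := by
  obtain ⟨hU, -, hX, -, -⟩ := hT
  have hu : u ∈ A ∨ u ∈ B := by simpa using hU.ge (mem_univ u)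
  have hv : v ∈ A ∨ v ∈ B := by simpa using hU.ge (mem_univ v)
  by_cases huA : u ∈ A
  · exact Xor.or (hX u huA v (hv.resolve_left (h.1 huA)))
  · exact (Xor.or (hX v (by tauto) u (hu.resolve_left huA))).symm

namespace IsCanonicalSeq

variable {E : V → V → Prop} {A B S : Set V} {l : ℕ} {X : ℕ → Set V}

theorem one_le_and_le (h : IsCanonicalSeq E S l X) {i : ℕ} {v : V} (hv : v ∈ X i) :
    1 ≤ i ∧ i ≤ l := by
  by_contra hi
  have := h.2.2.2 i (by omega)
  simp [this] at hv

theorem mem_layer (h : IsCanonicalSeq E S l X) {i : ℕ} {v : V} (hv : v ∈ X i) :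
    v ∈ S ∧ v ∉ SeqPrev X i ∧ ∀ u ∈ S, u ∉ SeqPrev X i → ¬ E u v := by
  obtain ⟨h1, h2⟩ := h.one_le_and_le hv
  rwa [h.1 i h1 h2] at hv

theorem exists_mem (h : IsCanonicalSeq E S l X) {v : V} (hv : v ∈ S) : ∃ i, v ∈ X i := by
  rw [← h.2.1] at hv
  obtain ⟨i, -, -, hi⟩ := hv
  exact ⟨i, hi⟩

theorem lt_of_arc (h : IsCanonicalSeq E S l X) {i j : ℕ} {u v : V} (hu : u ∈ X i)
    (hv : v ∈ X j) (huv : E u v) : i < j := by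
  by_contra hij
  refine (h.mem_layer hv).2.2 u (h.mem_layer hu).1 ?_ huv
  rintro ⟨k, hk1, hkj, hk⟩
  exact (h.mem_layer hu).2.1 ⟨k, hk1, by omega, hk⟩

theorem index_unique (h : IsCanonicalSeq E S l X) {i j : ℕ} {v : V} (hi : v ∈ X i)
    (hj : v ∈ X j) : i = j := by
  by_contra hij
  rcases Nat.lt_or_gt_of_ne hij with hlt | hlt
  · exact (h.mem_layer hj).2.1 ⟨i, (h.one_le_and_le hi).1, hlt, hi⟩
  · exact (h.mem_layer hi).2.1 ⟨j, (h.one_le_and_le hj).1, hlt, hj⟩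

/-- Every vertex outside the first layer has an in-neighbor in the preceding layer. -/
theorem exists_arc_from_pred (h : IsCanonicalSeq E S l X) {i : ℕ} {v : V} (hi : 1 ≤ i)
    (hv : v ∈ X (i + 1)) : ∃ u ∈ X i, E u v := by
  by_contra! hno
  have hvl := h.mem_layer hv
  have hi' := h.one_le_and_le hv
  have : v ∈ X i := by
    rw [h.1 i hi (by omega)]
    refine ⟨hvl.1, ?_, fun u hu hup huv => ?_⟩
    · rintro ⟨k, hk1, hki, hk⟩
      exact hvl.2.1 ⟨k, hk1, by omega, hk⟩
    · obtain ⟨k, hk⟩ := h.exists_mem hu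
      have hlt := h.lt_of_arc hk hv huv
      rcases Nat.lt_or_ge k i with hki | hki
      · exact hup ⟨k, (h.one_le_and_le hk).1, hki, hk⟩
      · obtain rfl : k = i := by omega
        exact hno u hk huv
  exact absurd (h.index_unique this hv) (by omega)

theorem same_side (h : IsCanonicalSeq E S l X) (hT : IsBipartiteTournament E A B) {i : ℕ}
    {u v : V} (hu : u ∈ X i) (hv : v ∈ X i) : u ∈ A ↔ v ∈ A := by
  by_contra hne
  rcases hT.arc_or_arc (u := u) (v := v) (by tauto) with huv | huv
  · exact lt_irrefl _ (h.lt_of_arc hu hv huv)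
  · exact lt_irrefl _ (h.lt_of_arc hv hu huv)

theorem arc_of_lt (h : IsCanonicalSeq E S l X) (hT : IsBipartiteTournament E A B) {i j : ℕ}
    {u v : V} (hu : u ∈ X i) (hv : v ∈ X j) (hij : i < j) (hside : u ∈ A ↔ v ∉ A) : E u v :=
  (hT.arc_or_arc hside).resolve_right fun hvu => hij.asymm (h.lt_of_arc hv hu hvu)

/-- Vertices in the same layer of a canonical sequence of the whole digraph are twins. -/
theorem outN_eq (h : IsCanonicalSeq E univ l X) (hT : IsBipartiteTournament E A B) {i : ℕ}
    {u v : V} (hu : u ∈ X i) (hv : v ∈ X i) : OutN E u = OutN E v := by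
  have hs := h.same_side hT hu hv
  ext w
  obtain ⟨k, hk⟩ := h.exists_mem (mem_univ w)
  constructor
  · intro (he : E u w)
    exact h.arc_of_lt hT hv hk (h.lt_of_arc hu hk he) (hs.symm.trans (hT.mem_iff_notMem he))
  · intro (he : E v w)
    exact h.arc_of_lt hT hu hk (h.lt_of_arc hv hk he) (hs.trans (hT.mem_iff_notMem he))

theorem inN_eq (h : IsCanonicalSeq E univ l X) (hT : IsBipartiteTournament E A B) {i : ℕ}
    {u v : V} (hu : u ∈ X i) (hv : v ∈ X i) : InN E u = InN E v := by
  have hs := h.same_side hT hu hv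
  ext w
  obtain ⟨k, hk⟩ := h.exists_mem (mem_univ w)
  constructor
  · intro (he : E w u)
    have := hT.mem_iff_notMem he
    exact h.arc_of_lt hT hk hv (h.lt_of_arc hk hu he) (by tauto)
  · intro (he : E w v)
    have := hT.mem_iff_notMem he
    exact h.arc_of_lt hT hk hu (h.lt_of_arc hk hv he) (by tauto)

theorem exists_isTopSortOn [Fintype V] (h : IsCanonicalSeq E univ l X) :
    ∃ π : V → ℕ, IsTopSortOn E univ π := by
  choose r hr using fun v => h.exists_mem (mem_univ v)
  let e := Fintype.equivFin V
  have key : ∀ u v, r u < r v →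
      r u * Fintype.card V + (e u : ℕ) < r v * Fintype.card V + (e v : ℕ) := by
    intro u v huv
    have h1 : (r u + 1) * Fintype.card V ≤ r v * Fintype.card V := Nat.mul_le_mul_right _ huv
    have h2 := (e u).isLt
    rw [Nat.add_mul] at h1
    omega
  refine ⟨fun v => r v * Fintype.card V + (e v : ℕ), ?_, ?_⟩
  · intro u _ v _ huv
    simp only at huv
    rcases lt_trichotomy (r u) (r v) with hlt | heq | hlt
    · exact absurd huv (key u v hlt).ne
    · rw [heq] at huv
      exact e.injective (Fin.ext (by omega))
    · exact absurd huv (key v u hlt).ne'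
  · intro u _ v _ huv
    exact key u v (h.lt_of_arc (hr u) (hr v) huv)

end IsCanonicalSeq

theorem AcyclicOn.mono {E : V → V → Prop} {S S' : Set V} (h : AcyclicOn E S') (hS : S ⊆ S') :
    AcyclicOn E S := fun v hv =>
  h v (Relation.TransGen.mono (fun _ _ hxy => ⟨hS hxy.1, hS hxy.2.1, hxy.2.2⟩) _ _ hv)

theorem IsTopSortOn.exists_first {E : V → V → Prop} {M : Set V} {π : V → ℕ} {v : V}
    (hπ : IsTopSortOn E univ π) (hin : ∀ u ∈ M, ¬ E u v) :
    ∃ π' : V → ℕ, IsTopSortOn E (M ∪ {v}) π' ∧ ∀ u ∈ M ∪ {v}, u ≠ v → π' v < π' u := by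
  classical
  refine ⟨fun u => if u = v then 0 else π u + 1, ⟨?_, ?_⟩, ?_⟩
  · intro x _ y _ hxy
    have := hπ.1 (mem_univ x) (mem_univ y)
    grind
  · intro x hx y hy hxy
    have := hπ.2 x (mem_univ x) y (mem_univ y) hxy
    grind
  · grind

theorem IsTopSortOn.exists_last [Fintype V] {E : V → V → Prop} {M : Set V} {π : V → ℕ} {v : V}
    (hπ : IsTopSortOn E univ π) (hout : ∀ u ∈ M, ¬ E v u) :
    ∃ π' : V → ℕ, IsTopSortOn E (M ∪ {v}) π' ∧ ∀ u ∈ M ∪ {v}, u ≠ v → π' u < π' v := by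
  classical
  have hle : ∀ u, π u ≤ Finset.univ.sup π := fun u => Finset.le_sup (Finset.mem_univ u)
  refine ⟨fun u => if u = v then Finset.univ.sup π + 1 else π u, ⟨?_, ?_⟩, ?_⟩
  · intro x _ y _ hxy
    have := hπ.1 (mem_univ x) (mem_univ y)
    have := hle x
    have := hle y
    grind
  · intro x hx y hy hxy
    have := hπ.2 x (mem_univ x) y (mem_univ y) hxy
    have := hle x
    grind
  · intro u _ huv
    have := hle u
    grind

/-- A vertex with both in- and out-neighbors in `M` is equivalent to or conflicting with some
layer of the canonical sequence of `T[M]`. -/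
theorem exists_mxEquiv_or_mxConflict {E : V → V → Prop} {A B M : Set V} {l : ℕ} {X : ℕ → Set V}
    {π : V → ℕ} (hT : IsBipartiteTournament E A B) (hπ : IsTopSortOn E univ π)
    (hX : IsCanonicalSeq E M l X) {v : V} (hin : ∃ u ∈ M, E u v) (hout : ∃ u ∈ M, E v u) :
    ∃ i, MXEquiv E M X i v ∨ MXConflict E X i v := by
  classical
  have hlt : ∀ {u w}, E u w → π u < π w := fun {u w} he => hπ.2 u (mem_univ u) w (mem_univ w) he
  have hex : ∃ j, (OutN E v ∩ X j).Nonempty := by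
    obtain ⟨u, hu, hvu⟩ := hout
    obtain ⟨j, hj⟩ := hX.exists_mem hu
    exact ⟨j, u, hvu, hj⟩
  obtain ⟨j, ⟨x, hvx, hxj⟩, hmin⟩ :
      ∃ j, (OutN E v ∩ X j).Nonempty ∧ ∀ k < j, OutN E v ∩ X k = ∅ :=
    ⟨Nat.find hex, Nat.find_spec hex,
      fun k hk => not_nonempty_iff_eq_empty.1 (Nat.find_min hex hk)⟩
  change E v x at hvx
  have hle : ∀ {k y}, y ∈ X k → E y v → k ≤ j := by
    intro k y hy hyv
    by_contra! hjk
    obtain ⟨k, rfl⟩ : ∃ k', k = k' + 1 := ⟨k - 1, by omega⟩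
    obtain ⟨z, hz, hzy⟩ :=
      hX.exists_arc_from_pred ((hX.one_le_and_le hxj).1.trans (by omega)) hy
    have s1 := hT.mem_iff_notMem hzy
    have s2 := hT.mem_iff_notMem hvx
    have s3 := hT.mem_iff_notMem hyv
    have hne : j ≠ k := by
      rintro rfl
      have := hX.same_side hT hz hxj
      tauto
    have hxz : E x z := hX.arc_of_lt hT hxj hz (by omega) (by tauto)
    have := hlt hxz
    have := hlt hzy
    have := hlt hyv
    have := hlt hvx
    omega
  have hge : ∀ {k y}, y ∈ X k → E v y → j ≤ k := by
    intro k y hy hvy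
    by_contra! hkj
    exact (hmin k hkj).le ⟨hvy, hy⟩
  by_cases hc : (InN E v ∩ X j).Nonempty
  · refine ⟨j, .inr ⟨⟨x, hvx, hxj⟩, hc, hmin, fun k hjk => ?_⟩⟩
    rw [← not_nonempty_iff_eq_empty]
    rintro ⟨y, hyv, hy⟩
    exact absurd (hle hy hyv) (by omega)
  have hlt' : ∀ {k y}, y ∈ X k → E y v → k < j := by
    intro k y hy hyv
    refine lt_of_le_of_ne (hle hy hyv) ?_
    rintro rfl
    exact hc ⟨y, hyv, hy⟩
  obtain ⟨y, hyM, hyv⟩ := hin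
  obtain ⟨k, hk⟩ := hX.exists_mem hyM
  have hkj := hlt' hk hyv
  have hk1 := (hX.one_le_and_le hk).1
  obtain ⟨j, rfl⟩ : ∃ j', j = j' + 1 := ⟨j - 1, by omega⟩
  obtain ⟨z, hz, hzx⟩ := hX.exists_arc_from_pred (by omega) hxj
  have hzv : z ∈ A ↔ v ∈ A :=
    (hT.mem_iff_notMem hzx).trans (hT.mem_iff_notMem hvx).symm
  refine ⟨j, .inl ⟨z, hz, ?_, ?_⟩⟩ <;> ext w <;> refine and_congr_left fun hwM => ?_
  all_goals
    obtain ⟨n, hn⟩ := hX.exists_mem hwM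
    refine ⟨fun he => ?_, fun he => ?_⟩
  · change E v w at he
    have := hT.mem_iff_notMem he
    exact hX.arc_of_lt hT hz hn (hge hn he) (by tauto)
  · change E z w at he
    have := hT.mem_iff_notMem he
    refine (hT.arc_or_arc (u := v) (v := w) (by tauto)).resolve_right fun hwv => ?_
    have := hlt' hn hwv
    have := hX.lt_of_arc hz hn he
    omega
  · change E w v at he
    have := hT.mem_iff_notMem he
    have hnj := hlt' hn he
    have hne : n ≠ j := by
      rintro rfl
      have := hX.same_side hT hn hz
      tauto
    exact hX.arc_of_lt hT hn hz (by omega) (by tauto)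
  · change E w z at he
    have := hT.mem_iff_notMem he
    refine (hT.arc_or_arc (u := w) (v := v) (by tauto)).resolve_right fun hvw => ?_
    have := hge hn hvw
    have := hX.lt_of_arc hn hz he
    omega

theorem stmt_9 [Fintype V] (E : V → V → Prop) (A B : Set V)
    (hT : IsBipartiteTournament E A B) (hac : AcyclicOn E Set.univ)
    (M : Set V) (m : ℕ) (W : ℕ → Set V) (hW : IsCanonicalSeq E Set.univ m W)
    (l : ℕ) (hl : 1 ≤ l) (X' X Y : ℕ → Set V)
    (hseq : IsMSeqOn E Set.univ M l X' X Y) :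
    ∀ i, 1 ≤ i → i ≤ m → ∃ j, 1 ≤ j ∧ j ≤ l ∧ (W i ⊆ X j ∨ W i ⊆ Y j) := by
  intro i _ _
  obtain ⟨hX', hX, hY, -⟩ := hseq
  obtain hWi | ⟨v, hv⟩ := (W i).eq_empty_or_nonempty
  · exact ⟨1, le_rfl, hl, .inl (hWi ▸ empty_subset _)⟩
  obtain ⟨π, hπ⟩ := hW.exists_isTopSortOn
  have hO : ∀ {u}, u ∈ W i → OutN E u = OutN E v := fun hu => hW.outN_eq hT hu hv
  have hI : ∀ {u}, u ∈ W i → InN E u = InN E v := fun hu => hW.inN_eq hT hu hv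
  have hequiv : ∀ {u}, u ∈ W i → ∀ j, MXEquiv E M X' j u ↔ MXEquiv E M X' j v := by
    intro u hu j
    simp only [MXEquiv, MEquiv, hO hu, hI hu]
  by_cases he : ∃ j, MXEquiv E M X' j v
  · obtain ⟨j, hj⟩ := he
    obtain ⟨h1, h2⟩ := hX'.one_le_and_le hj.choose_spec.1
    refine ⟨j, h1, h2, .inl fun u hu => ?_⟩
    rw [hX j h1 h2]
    exact ⟨mem_univ u, (hequiv hu j).2 hj⟩
  have hne : ∀ {u}, u ∈ W i → ∀ j, ¬ MXEquiv E M X' j u :=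
    fun hu j hj => he ⟨j, (hequiv hu j).1 hj⟩
  by_cases hin : ∃ u ∈ M, E u v
  · by_cases hout : ∃ u ∈ M, E v u
    · obtain ⟨j, hj | hj⟩ := exists_mxEquiv_or_mxConflict hT hπ hX' hin hout
      · exact absurd ⟨j, hj⟩ he
      · obtain ⟨h1, h2⟩ := hX'.one_le_and_le hj.1.choose_spec.2
        refine ⟨j, h1, h2, .inr fun u hu => ?_⟩
        rw [hY j h1 h2]
        refine .inl (.inl ⟨mem_univ u, ?_⟩)
        simpa only [MXConflict, hO hu, hI hu] using hj
    · refine ⟨l, hl, le_rfl, .inr fun u hu => ?_⟩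
      rw [hY l hl le_rfl, if_pos (rfl : l = l)]
      refine .inr ⟨mem_univ u, hne hu, hac.mono (subset_univ _),
        hπ.exists_last fun w hw huw => hout ⟨w, hw, ?_⟩⟩
      exact (hO hu).le huw
  · refine ⟨1, le_rfl, hl, .inr fun u hu => ?_⟩
    rw [hY 1 le_rfl hl, if_pos (rfl : 1 = 1)]
    refine .inl (.inr ⟨mem_univ u, hne hu, hac.mono (subset_univ _),
      hπ.exists_first fun w hw hwu => hin ⟨w, hw, ?_⟩⟩)
    exact (hI hu).le hwu
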